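/- In the Temperley–Lieb algebra TL_n^ℚ, the elements E_t (for t ranging over the two-column standard tableaux of size n) defined by the content-product formula satisfy: Σ_{t ∈ Std(Par^{≤2}_n)} E_t = 1; E_s E_t = δ_{s,t} E_s for all s, t ∈ Std(Par^{≤2}_n); and 𝐋_i E_t = E_t 𝐋_i = c_t(i) E_t for all i = 1, …, n and all t ∈ Std(Par^{≤2}_n). -/

import Mathlib

/-- Relations defining the Temperley–Lieb algebra with loop parameter `2`,
on generators `u_1, …, u_{n-1}` (indexed by `Fin (n-1)`). -/
inductive TLRel (R : Type) [CommRing R] (n : ℕ) :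
    FreeAlgebra R (Fin (n - 1)) → FreeAlgebra R (Fin (n - 1)) → Prop
  | sq (i : Fin (n - 1)) :
      TLRel R n (FreeAlgebra.ι R i * FreeAlgebra.ι R i) (2 * FreeAlgebra.ι R i)
  | braid (i j : Fin (n - 1)) (h : Nat.dist i.val j.val = 1) :
      TLRel R n (FreeAlgebra.ι R i * FreeAlgebra.ι R j * FreeAlgebra.ι R i) (FreeAlgebra.ι R i)
  | comm (i j : Fin (n - 1)) (h : 1 < Nat.dist i.val j.val) :
      TLRel R n (FreeAlgebra.ι R i * FreeAlgebra.ι R j) (FreeAlgebra.ι R j * FreeAlgebra.ι R i)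

/-- The Temperley–Lieb algebra `TL_n` over `R`, with loop parameter `2`. -/
abbrev TL (R : Type) [CommRing R] (n : ℕ) : Type := RingQuot (TLRel R n)

/-- The generator `u_{i+1}` of the Temperley–Lieb algebra. -/
noncomputable def TLu (R : Type) [CommRing R] (n : ℕ) (i : Fin (n - 1)) : TL R n :=
  RingQuot.mkAlgHom R (TLRel R n) (FreeAlgebra.ι R i)


/-- A two-column standard Young tableau of size `n`, encoded by the function
`col : Fin n → Fin 2` recording the column (`0` = first, `1` = second) containing
the entry `j+1`, subject to the ballot (lattice word) condition, which is
equivalent to standardness. -/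
structure TwoColTab (n : ℕ) where
  col : Fin n → Fin 2
  ballot : ∀ m : Fin n,
    (Finset.univ.filter fun i : Fin n => i ≤ m ∧ col i = 1).card ≤
    (Finset.univ.filter fun i : Fin n => i ≤ m ∧ col i = 0).card

theorem TwoColTab.ext' {n : ℕ} : ∀ {s t : TwoColTab n}, s.col = t.col → s = t
  | ⟨a, _⟩, ⟨b, _⟩, h => by
      obtain rfl : a = b := h
      rfl

noncomputable instance (n : ℕ) : Fintype (TwoColTab n) :=
  Fintype.ofInjective TwoColTab.col (fun _ _ h => TwoColTab.ext' h)

/-- The content `c_t(j+1) = (column of j+1) − (row of j+1)` of the entry `j+1`,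
computed from the column word `c`: if `j+1` lies in column `k ∈ {1,2}` then its row
is the number of `i ≤ j+1` lying in column `k`, and its content is `k − row`. -/
def colContent {n : ℕ} (c : Fin n → Fin 2) (j : Fin n) : ℤ :=
  if c j = 0 then
    1 - ((Finset.univ.filter fun i : Fin n => i ≤ j ∧ c i = 0).card : ℤ)
  else
    2 - ((Finset.univ.filter fun i : Fin n => i ≤ j ∧ c i = 1).card : ℤ)

/-- The content function of a two-column standard tableau. -/
def tabContent {n : ℕ} (t : TwoColTab n) (j : Fin n) : ℤ := colContent t.col j

/-- Membership in the `p`-class of the one-column standard tableau `t_n`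
(whose content at the entry `j+1` is `−j`), expressed on column words. -/
def inOneColClass (p n : ℕ) (c : Fin n → Fin 2) : Prop :=
  ∀ j : Fin n, ((colContent c j : ℤ) : ZMod p) = ((-(j.val : ℤ) : ℤ) : ZMod p)

/-- Two tableaux are in the same `p`-class if their contents agree modulo `p`. -/
def pClassEq (p n : ℕ) (s t : TwoColTab n) : Prop :=
  ∀ j : Fin n, ((tabContent s j : ℤ) : ZMod p) = ((tabContent t j : ℤ) : ZMod p)

/-- The one-column standard tableau `t_n`. -/
def oneColTab (n : ℕ) : TwoColTab n :=
  ⟨fun _ => 0, by intro m; simp⟩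

/-- The group algebra `R𝔖_n` of the symmetric group on `{1, …, n}`. -/
abbrev SymGrpAlg (R : Type) [CommRing R] (n : ℕ) : Type := MonoidAlgebra R (Equiv.Perm (Fin n))

/-- The simple transposition `s_{i+1} = (i+1, i+2)` (1-based) in `𝔖_n`, for `i : Fin (n-1)`. -/
def simpleT (n : ℕ) (i : Fin (n - 1)) : Equiv.Perm (Fin n) :=
  Equiv.swap ⟨i.val, by have := i.isLt; omega⟩ ⟨i.val + 1, by have := i.isLt; omega⟩

/-- The Jucys–Murphy element `L_{l+1} = (1,l+1) + (2,l+1) + ⋯ + (l,l+1)` (1-based)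
in the group algebra, for `l : Fin n`; in particular `L_1 = 0`. -/
noncomputable def JMelt (R : Type) [CommRing R] (n : ℕ) (l : Fin n) : SymGrpAlg R n :=
  ∑ j ∈ Finset.univ.filter (fun j : Fin n => j < l),
    MonoidAlgebra.of R (Equiv.Perm (Fin n)) (Equiv.swap j l)

/-- The set `𝒞` of all contents `c_s(i)` of entries of two-column standard tableaux of
size `n`, as a finite set of integers. -/
noncomputable def ContSet (n : ℕ) : Finset ℤ :=
  ((Finset.univ : Finset ((Fin n → Fin 2) × Fin n)).filter fun x =>
      ∀ m : Fin n,
        (Finset.univ.filter fun i : Fin n => i ≤ m ∧ x.1 i = 1).card ≤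
        (Finset.univ.filter fun i : Fin n => i ≤ m ∧ x.1 i = 0).card).image
    fun x => colContent x.1 x.2

/-- The seminormal idempotent
`E_t = ∏_{c ∈ 𝒞} ∏_{1 ≤ i ≤ n, c_t(i) ≠ c} (𝐋_i − c)/(c_t(i) − c)`
attached to the content function of the column word `c`; here `L : Fin n → TL ℚ n`
is the family of Jucys–Murphy elements `𝐋_i` of `TL_n^ℚ`.  (All the factors commute,
so the ordered product below agrees with the usual product.) -/
noncomputable def EeltC (n : ℕ) (L : Fin n → TL ℚ n) (c : Fin n → Fin 2) : TL ℚ n :=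
  (((ContSet n).sort (· ≤ ·)).map fun d =>
    (((List.finRange n).filter fun i => colContent c i ≠ d).map fun i =>
      (((colContent c i - d : ℤ) : ℚ))⁻¹ • (L i - (d : TL ℚ n))).prod).prod

/-- The seminormal idempotent `E_t` of a two-column standard tableau `t`. -/
noncomputable def Eelt (n : ℕ) (L : Fin n → TL ℚ n) (t : TwoColTab n) : TL ℚ n :=
  EeltC n L t.col


/-- A family of elements of a ring behaving like the transpositions `(i, j)` with `i, j < n`,
such that the sum over the symmetric group on any three letters vanishes. -/
structure IsThreeSymmetrizerFree {A : Type*} [Ring A] (n : ℕ) (T : ℕ → ℕ → A) : Prop where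
  symm (i j : ℕ) : T i j = T j i
  diag (i : ℕ) : T i i = 1
  sq (i j : ℕ) : T i j * T i j = 1
  conj {i j k l : ℕ} (hi : i < n) (hj : j < n) (hk : k < n) (hl : l < n) :
    T i j * T k l = T (Equiv.swap i j k) (Equiv.swap i j l) * T i j
  symmetrizer {i j k : ℕ} (hi : i < n) (hj : j < n) (hk : k < n)
    (hij : i ≠ j) (hik : i ≠ k) (hjk : j ≠ k) :
    1 + T i j + T i k + T j k + T i k * T j k + T j k * T i k = 0

section JucysMurphy

variable {A : Type*} [Ring A]

/-- The `l`-th Jucys–Murphy element (zero-based) of a family of transpositions. -/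
def jucysMurphy (T : ℕ → ℕ → A) (l : ℕ) : A := ∑ j ∈ Finset.range l, T j l

/-- The sum of the first `m` Jucys–Murphy elements. -/
def jmSum (T : ℕ → ℕ → A) (m : ℕ) : A := ∑ l ∈ Finset.range m, jucysMurphy T l

theorem jmSum_succ (T : ℕ → ℕ → A) (m : ℕ) :
    jmSum T (m + 1) = jmSum T m + jucysMurphy T m :=
  Finset.sum_range_succ _ _

theorem swap_lt {i j k m : ℕ} (hi : i < m) (hj : j < m) : Equiv.swap i j k < m ↔ k < m := by
  rw [Equiv.swap_apply_def]
  split_ifs <;> omega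

namespace IsThreeSymmetrizerFree

variable {n : ℕ} {T : ℕ → ℕ → A}

theorem commute_jucysMurphy (h : IsThreeSymmetrizerFree n T) {i j l : ℕ} (hi : i < l) (hj : j < l)
    (hl : l < n) : Commute (T i j) (jucysMurphy T l) := by
  rw [Commute, SemiconjBy, jucysMurphy, Finset.mul_sum, Finset.sum_mul]
  refine Finset.sum_equiv (Equiv.swap i j) (fun k => ?_) (fun k hk => ?_)
  · simp only [Finset.mem_range, swap_lt hi hj]
  · rw [Finset.mem_range] at hk
    rw [h.conj (hi.trans hl) (hj.trans hl) (hk.trans hl) hl,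
      Equiv.swap_apply_of_ne_of_ne (a := i) (b := j) (x := l) hi.ne' hj.ne']

theorem commute_of_disjoint (h : IsThreeSymmetrizerFree n T) {i j k l : ℕ}
    (hi : i < n) (hj : j < n) (hk : k < n) (hl : l < n)
    (hki : k ≠ i) (hkj : k ≠ j) (hli : l ≠ i) (hlj : l ≠ j) : Commute (T i j) (T k l) := by
  rw [Commute, SemiconjBy, h.conj hi hj hk hl, Equiv.swap_apply_of_ne_of_ne hki hkj,
    Equiv.swap_apply_of_ne_of_ne hli hlj]

theorem commute_jmSum_of_le (h : IsThreeSymmetrizerFree n T) {i j m : ℕ}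
    (hmi : m ≤ i) (hmj : m ≤ j) (hi : i < n) (hj : j < n) : Commute (T i j) (jmSum T m) := by
  refine Commute.sum_right _ _ _ fun l hl => Commute.sum_right _ _ _ fun k hk => ?_
  rw [Finset.mem_range] at hl hk
  apply h.commute_of_disjoint hi hj <;> omega

theorem sum_sum_eq (h : IsThreeSymmetrizerFree n T) (m : ℕ) :
    ∑ i ∈ Finset.range m, ∑ j ∈ Finset.range m, T i j = 2 * jmSum T m + m := by
  induction m with
  | zero => simp [jmSum]
  | succ m ih =>
    have hrow : ∑ j ∈ Finset.range m, T m j = jucysMurphy T m :=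
      Finset.sum_congr rfl fun j _ => h.symm m j
    simp only [Finset.sum_range_succ, Finset.sum_add_distrib, ih, hrow, h.diag, jmSum_succ]
    rw [← jucysMurphy]
    push_cast
    noncomm_ring

theorem jucysMurphy_commute (h : IsThreeSymmetrizerFree n T) {k l : ℕ} (hk : k < n) (hl : l < n) :
    Commute (jucysMurphy T k) (jucysMurphy T l) := by
  wlog hkl : k < l generalizing k l
  · rcases eq_or_lt_of_le (not_lt.mp hkl) with rfl | hlt
    · exact Commute.refl _
    · exact (this hl hk hlt).symm
  refine Commute.sum_left _ _ _ fun j hj => ?_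
  rw [Finset.mem_range] at hj
  exact h.commute_jucysMurphy (hj.trans hkl) hkl hl

theorem jmSum_commute_jucysMurphy (h : IsThreeSymmetrizerFree n T) {m l : ℕ} (hm : m ≤ n)
    (hl : l < n) : Commute (jmSum T m) (jucysMurphy T l) := by
  refine Commute.sum_left _ _ _ fun j hj => ?_
  rw [Finset.mem_range] at hj
  exact h.jucysMurphy_commute (hj.trans_le hm) hl

theorem swap_mul_jucysMurphy_succ (h : IsThreeSymmetrizerFree n T) {a : ℕ} (ha : a + 1 < n) :
    T a (a + 1) * jucysMurphy T (a + 1) = jucysMurphy T a * T a (a + 1) + 1 := by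
  simp only [jucysMurphy, Finset.sum_range_succ, mul_add, h.sq, Finset.mul_sum, Finset.sum_mul]
  congr 1
  refine Finset.sum_congr rfl fun j hj => ?_
  rw [Finset.mem_range] at hj
  rw [h.conj (by omega) ha (by omega) ha, Equiv.swap_apply_right,
    Equiv.swap_apply_of_ne_of_ne (by omega) (by omega)]

variable [Algebra ℚ A]

theorem commute_jmSum (h : IsThreeSymmetrizerFree n T) {i j m : ℕ} (hi : i < m) (hj : j < m)
    (hm : m ≤ n) : Commute (T i j) (jmSum T m) := by
  have hS : Commute (T i j) (∑ k ∈ Finset.range m, ∑ l ∈ Finset.range m, T k l) := by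
    simp only [Commute, SemiconjBy, Finset.mul_sum, Finset.sum_mul]
    refine Finset.sum_equiv (Equiv.swap i j) (fun k => ?_) (fun k hk => ?_)
    · simp only [Finset.mem_range, swap_lt hi hj]
    refine Finset.sum_equiv (Equiv.swap i j) (fun l => ?_) (fun l hl => ?_)
    · simp only [Finset.mem_range, swap_lt hi hj]
    rw [Finset.mem_range] at hk hl
    exact h.conj (by omega) (by omega) (by omega) (by omega)
  have hz : jmSum T m = (1 / 2 : ℚ) •
      (∑ k ∈ Finset.range m, ∑ l ∈ Finset.range m, T k l - (m : A)) := by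
    rw [h.sum_sum_eq, add_sub_cancel_right, two_mul]
    module
  rw [hz]
  exact (hS.sub_right (Nat.commute_cast _ _)).smul_right _

theorem jucysMurphy_quadratic (h : IsThreeSymmetrizerFree n T) {m : ℕ} (hm : m < n) :
    jucysMurphy T m * jucysMurphy T m + (m - 1 : ℚ) • jucysMurphy T m + jmSum T m
      + (m * (m - 3) / 2 : ℚ) • (1 : A) = 0 := by
  have hpair : ∀ i ∈ Finset.range m, ∀ j ∈ Finset.range m,
      T i m * T j m + T j m * T i m =
        -(1 + T i j + T i m + T j m) + if i = j then (4 : ℚ) • (1 : A) + (2 : ℚ) • T i m else 0 := by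
    intro i hi j hj
    rw [Finset.mem_range] at hi hj
    split_ifs with hij
    · subst hij
      rw [h.sq, h.diag]
      module
    · have := h.symmetrizer (hi.trans hm) (hj.trans hm) hm hij hi.ne hj.ne
      rw [add_zero, eq_neg_iff_add_eq_zero, ← this]
      abel
  have hsum : ∑ i ∈ Finset.range m, ∑ j ∈ Finset.range m,
      (T i m * T j m + T j m * T i m) =
      jucysMurphy T m * jucysMurphy T m + jucysMurphy T m * jucysMurphy T m := by
    simp only [Finset.sum_add_distrib]
    congr 1
    · rw [jucysMurphy, Finset.sum_mul_sum]
    · rw [Finset.sum_comm, jucysMurphy, Finset.sum_mul_sum]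
  rw [Finset.sum_congr rfl fun i hi => Finset.sum_congr rfl fun j hj => hpair i hi j hj] at hsum
  simp only [Finset.sum_add_distrib, Finset.sum_neg_distrib, h.sum_sum_eq, Finset.sum_ite_eq,
    Finset.sum_const, Finset.card_range] at hsum
  rw [Finset.sum_congr rfl fun i hi => if_pos hi] at hsum
  simp only [Finset.sum_add_distrib, ← Finset.smul_sum, Finset.sum_const, Finset.card_range] at hsum
  rw [← jucysMurphy] at hsum
  generalize jucysMurphy T m * jucysMurphy T m = P at hsum ⊢
  simp only [← nsmul_one (A := A) m, two_mul, ← Nat.cast_smul_eq_nsmul ℚ] at hsum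
  linear_combination (norm := module) (-1 / 2 : ℚ) • hsum

theorem jucysMurphy_quadratic_mul (h : IsThreeSymmetrizerFree n T) {m : ℕ} (hm : m < n) (v : A) :
    jucysMurphy T m * (jucysMurphy T m * v) + (m - 1 : ℚ) • (jucysMurphy T m * v) + jmSum T m * v
      + (m * (m - 3) / 2 : ℚ) • v = 0 := by
  have := congrArg (· * v) (h.jucysMurphy_quadratic hm)
  simpa only [add_mul, smul_mul_assoc, one_mul, zero_mul, mul_assoc] using this


theorem eq_zero_of_jmSum_mul_aux (h : IsThreeSymmetrizerFree n T) {p : ℕ} (hp : 2 * p + 2 < n)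
    (ih : ∀ v : A, jmSum T (2 * p + 1) * v = (-p ^ 2 + p + 1 : ℚ) • v → v = 0)
    {v : A} (hL : jucysMurphy T (2 * p + 2) * v = (-p : ℚ) • v)
    (hz : jmSum T (2 * p + 2) * v = (-p ^ 2 + 1 : ℚ) • v) : v = 0 := by
  have hneg : ∀ v : A, jucysMurphy T (2 * p + 2) * v = (-p : ℚ) • v →
      jmSum T (2 * p + 2) * v = (-p ^ 2 + 1 : ℚ) • v →
      T (2 * p + 1) (2 * p + 2) * v = -v := by
    intro v hL hz
    set L' := jucysMurphy T (2 * p + 1)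
    set s := T (2 * p + 1) (2 * p + 2)
    have hz' : jmSum T (2 * p + 1) * v = (-p ^ 2 + 1 : ℚ) • v - L' * v := by
      rw [← hz, jmSum_succ T (2 * p + 1), add_mul, add_sub_cancel_right]
    have hq := h.jucysMurphy_quadratic_mul (m := 2 * p + 1) (by omega) v
    rw [hz'] at hq
    push_cast at hq
    have hL' : L' * v = (1 - p : ℚ) • v := by
      have hy : L' * v - (1 - p : ℚ) • v = 0 := by
        apply ih
        have hc : jmSum T (2 * p + 1) * (L' * v) = L' * (jmSum T (2 * p + 1) * v) := by
          rw [← mul_assoc, (h.jmSum_commute_jucysMurphy (by omega) (by omega)).eq, mul_assoc]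
        rw [mul_sub, mul_smul_comm, hc, hz', mul_sub, mul_smul_comm]
        linear_combination (norm := module) (-1 : ℚ) • hq
      exact sub_eq_zero.mp hy
    have hdaha : s * (jucysMurphy T (2 * p + 2) * v) = L' * (s * v) + v := by
      rw [← mul_assoc, h.swap_mul_jucysMurphy_succ (by omega), add_mul, one_mul, mul_assoc]
    rw [hL, mul_smul_comm] at hdaha
    have hcs : jmSum T (2 * p + 1) * (s * v) = s * (jmSum T (2 * p + 1) * v) := by
      rw [← mul_assoc, ← (h.commute_jmSum_of_le (m := 2 * p + 1) (by omega) (by omega)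
        (by omega) hp).eq, mul_assoc]
    have hw : L' * (s * v + v) = (-p : ℚ) • (s * v + v) := by
      rw [mul_add, hL']
      linear_combination (norm := module) (-1 : ℚ) • hdaha
    have hzw : jmSum T (2 * p + 1) * (s * v + v) = (-p ^ 2 + p : ℚ) • (s * v + v) := by
      rw [mul_add, hcs, hz', hL', mul_sub, mul_smul_comm, mul_smul_comm]
      module
    have hqw := h.jucysMurphy_quadratic_mul (m := 2 * p + 1) (by omega) (s * v + v)
    rw [hw, mul_smul_comm, hw, hzw] at hqw
    push_cast at hqw
    rw [eq_neg_iff_add_eq_zero]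
    linear_combination (norm := module) (-1 : ℚ) • hqw
  have hswap : ∀ j < 2 * p + 2, T j (2 * p + 2) * v = -v := by
    intro j hj
    rcases eq_or_ne j (2 * p + 1) with rfl | hne
    · exact hneg v hL hz
    have hconj : T j (2 * p + 2) =
        T j (2 * p + 1) * T (2 * p + 1) (2 * p + 2) * T j (2 * p + 1) := by
      rw [h.conj (by omega) (by omega) (by omega) hp, Equiv.swap_apply_right,
        Equiv.swap_apply_of_ne_of_ne (by omega) (by omega), mul_assoc, h.sq, mul_one]
    have h1 := hneg (T j (2 * p + 1) * v)
      (by rw [← mul_assoc, ← (h.commute_jucysMurphy hj (by omega) hp).eq, mul_assoc, hL,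
        mul_smul_comm])
      (by rw [← mul_assoc, ← (h.commute_jmSum hj (by omega) hp.le).eq, mul_assoc, hz,
        mul_smul_comm])
    rw [hconj, mul_assoc, mul_assoc, h1, mul_neg, ← mul_assoc, h.sq, one_mul]
  have hLv : jucysMurphy T (2 * p + 2) * v = -((2 * p + 2 : ℚ) • v) := by
    rw [jucysMurphy, Finset.sum_mul,
      Finset.sum_congr rfl fun j hj => hswap j (Finset.mem_range.mp hj), Finset.sum_const,
      Finset.card_range, ← Nat.cast_smul_eq_nsmul ℚ]
    push_cast
    module
  have hv : (p + 2 : ℚ) • v = 0 := by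
    linear_combination (norm := module) hLv - hL
  exact (smul_eq_zero.mp hv).resolve_left (by positivity)

/-- The sum of the first `2 * p + 1` Jucys–Murphy elements does not have the eigenvalue that the
(non-partition) shape with columns of lengths `p` and `p + 1` would give. -/
theorem eq_zero_of_jmSum_mul (h : IsThreeSymmetrizerFree n T) {p : ℕ} (hp : 2 * p + 1 ≤ n)
    {v : A} (hv : jmSum T (2 * p + 1) * v = (-p ^ 2 + p + 1 : ℚ) • v) : v = 0 := by
  induction p generalizing v with
  | zero => simpa [jmSum, jucysMurphy] using hv.symm
  | succ p ih =>
    have hp' : 2 * p + 2 < n := by omega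
    have key := fun v => h.eq_zero_of_jmSum_mul_aux (v := v) hp' fun w hw => ih (by omega) hw
    have hstep : ∀ w : A,
        jmSum T (2 * (p + 1) + 1) * w = (-(p + 1 : ℕ) ^ 2 + (p + 1 : ℕ) + 1 : ℚ) • w →
        jucysMurphy T (2 * p + 2) * w = (-p : ℚ) • w → w = 0 := by
      intro w hw hL
      refine key w hL ?_
      rw [jmSum_succ, add_mul, mul_add_one, hL] at hw
      push_cast at hw
      linear_combination (norm := module) hw
    refine hstep v hv (sub_eq_zero.mp ?_)
    have hz : jmSum T (2 * p + 2) * v =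
        (-(p + 1 : ℕ) ^ 2 + (p + 1 : ℕ) + 1 : ℚ) • v - jucysMurphy T (2 * p + 2) * v := by
      rw [← hv, mul_add_one, jmSum_succ T (2 * p + 2), add_mul, add_sub_cancel_right]
    have hq := h.jucysMurphy_quadratic_mul hp' v
    rw [hz] at hq
    push_cast at hq
    apply hstep
    · have hc : jmSum T (2 * (p + 1) + 1) * (jucysMurphy T (2 * p + 2) * v) =
          jucysMurphy T (2 * p + 2) * (jmSum T (2 * (p + 1) + 1) * v) := by
        rw [← mul_assoc, (h.jmSum_commute_jucysMurphy hp hp').eq, mul_assoc]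
      rw [mul_sub, mul_smul_comm, hc, hv, mul_smul_comm]
      module
    · rw [mul_sub, mul_smul_comm]
      linear_combination (norm := module) hq

end IsThreeSymmetrizerFree

/-- The content of the `l`-th (zero-based) entry of the two-column tableau with column word `c`. -/
def wordContent (c : ℕ → Fin 2) (l : ℕ) : ℤ :=
  if c l = 0 then -(Nat.count (c · = 0) l : ℤ) else 1 - (Nat.count (c · = 1) l : ℤ)

variable [Algebra ℚ A]

/-- The vectors that are simultaneous eigenvectors of the first `m` Jucys–Murphy elements, with
eigenvalues the contents of a standard two-column tableau. -/
def contentVectors (T : ℕ → ℕ → A) (m : ℕ) : Set A :=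
  {x | ∃ c : ℕ → Fin 2, (∀ l ≤ m, Nat.count (c · = 1) l ≤ Nat.count (c · = 0) l) ∧
    ∀ l < m, jucysMurphy T l * x = (wordContent c l : ℚ) • x}

theorem count_update_of_le (c : ℕ → Fin 2) (k : Fin 2) {m l : ℕ} (hl : l ≤ m) (a : Fin 2) :
    Nat.count (Function.update c m a · = k) l = Nat.count (c · = k) l := by
  rw [Nat.count_eq_card_filter_range, Nat.count_eq_card_filter_range]
  congr 1
  refine Finset.filter_congr fun i hi => ?_
  rw [Finset.mem_range] at hi
  rw [Function.update_of_ne (by omega)]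

theorem count_zero_add_count_one (c : ℕ → Fin 2) (m : ℕ) :
    Nat.count (c · = 0) m + Nat.count (c · = 1) m = m := by
  induction m with
  | zero => simp
  | succ m ih =>
    rw [Nat.count_succ, Nat.count_succ]
    by_cases hc : c m = 0
    · simp [hc]; omega
    · have hc1 : c m = 1 := by omega
      simp [hc1]; omega

theorem wordContent_update_of_lt (c : ℕ → Fin 2) {m l : ℕ} (hl : l < m) (a : Fin 2) :
    wordContent (Function.update c m a) l = wordContent c l := by
  simp only [wordContent, count_update_of_le c _ hl.le, Function.update_of_ne hl.ne]

theorem jmSum_mul_of_word {T : ℕ → ℕ → A} {c : ℕ → Fin 2} {m : ℕ} {x : A}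
    (hx : ∀ l < m, jucysMurphy T l * x = (wordContent c l : ℚ) • x) :
    jmSum T m * x = ((Nat.count (c · = 0) m * (1 - Nat.count (c · = 0) m)
      + Nat.count (c · = 1) m * (3 - Nat.count (c · = 1) m)) / 2 : ℚ) • x := by
  induction m with
  | zero => simp [jmSum]
  | succ m ih =>
    rw [jmSum_succ, add_mul, ih fun l hl => hx l (by omega), hx m (by omega), ← add_smul]
    congr 1
    rw [Nat.count_succ, Nat.count_succ, wordContent]
    by_cases hc : c m = 0
    · simp [hc]; ring
    · have hc1 : c m = 1 := by omega
      simp [hc1]; ring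

theorem extend_word {T : ℕ → ℕ → A} {c : ℕ → Fin 2} {m : ℕ} {x : A}
    (hb : ∀ l ≤ m, Nat.count (c · = 1) l ≤ Nat.count (c · = 0) l)
    (hx : ∀ l < m, jucysMurphy T l * x = (wordContent c l : ℚ) • x) (a : Fin 2)
    (ha : a = 1 → Nat.count (c · = 1) m < Nat.count (c · = 0) m)
    (hm : jucysMurphy T m * x =
      (if a = 0 then -(Nat.count (c · = 0) m : ℚ) else 1 - (Nat.count (c · = 1) m : ℚ)) • x) :
    x ∈ contentVectors T (m + 1) := by
  refine ⟨Function.update c m a, fun l hl => ?_, fun l hl => ?_⟩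
  · rcases Nat.le_succ_iff.mp hl with hl | rfl
    · simpa only [count_update_of_le c _ hl] using hb l hl
    · have := hb m le_rfl
      rw [Nat.count_succ, Nat.count_succ, count_update_of_le c _ le_rfl,
        count_update_of_le c _ le_rfl, Function.update_self]
      by_cases h1 : a = 1
      · have := ha h1
        simp [h1]; omega
      · simp [h1]; omega
  · rcases Nat.lt_succ_iff_lt_or_eq.mp hl with hl | rfl
    · rw [wordContent_update_of_lt c hl, hx l hl]
    · rw [hm, wordContent, count_update_of_le c _ le_rfl, count_update_of_le c _ le_rfl,
        Function.update_self]
      congr 1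
      split_ifs <;> simp

theorem IsThreeSymmetrizerFree.contentVectors_subset_span {n : ℕ} {T : ℕ → ℕ → A}
    (h : IsThreeSymmetrizerFree n T) {m : ℕ} (hm : m < n) :
    contentVectors T m ⊆ Submodule.span ℚ (contentVectors T (m + 1)) := by
  rintro x ⟨c, hb, hx⟩
  have hz := jmSum_mul_of_word hx
  have hq := h.jucysMurphy_quadratic_mul hm x
  have hpq : (m : ℚ) = Nat.count (c · = 0) m + Nat.count (c · = 1) m := by
    exact_mod_cast (count_zero_add_count_one c m).symm
  have hmpq := count_zero_add_count_one c m
  have hle := hb m le_rfl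
  have hext := fun (y : A) hy => extend_word (T := T) (x := y) hb hy
  set L := jucysMurphy T m
  have hcomm : ∀ b : ℚ, ∀ l < m, jucysMurphy T l * (L * x + b • x) =
      (wordContent c l : ℚ) • (L * x + b • x) := by
    intro b l hl
    rw [mul_add, ← mul_assoc, (h.jucysMurphy_commute (hl.trans hm) hm).eq, mul_assoc, hx l hl,
      mul_smul_comm, mul_smul_comm, hx l hl]
    module
  generalize hp : Nat.count (c · = 0) m = p at *
  generalize hq' : Nat.count (c · = 1) m = q at *
  rw [hz, hpq] at hq
  have h0 : L * (L * x + (q - 1 : ℚ) • x) = (-p : ℚ) • (L * x + (q - 1 : ℚ) • x) := by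
    rw [mul_add, mul_smul_comm]
    linear_combination (norm := module) hq
  have h1 : L * (L * x + (p : ℚ) • x) = (1 - q : ℚ) • (L * x + (p : ℚ) • x) := by
    rw [mul_add, mul_smul_comm]
    linear_combination (norm := module) hq
  rcases eq_or_lt_of_le hle with heq | hlt
  · apply Submodule.subset_span
    refine hext x hx 0 (by simp) ?_
    rw [if_pos rfl]
    subst heq
    have hzero : L * x + (q : ℚ) • x = 0 := by
      refine h.eq_zero_of_jmSum_mul (p := q) (by omega) ?_
      have hmm : m = 2 * q := by omega
      rw [← hmm, jmSum_succ, add_mul, h1, jmSum_mul_of_word (hcomm _), hp, hq']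
      module
    linear_combination (norm := module) hzero
  · have m0 := hext _ (hcomm (q - 1)) 0 (by simp) (by simpa using h0)
    have m1 := hext _ (hcomm p) 1 (fun _ => hlt) (by simpa using h1)
    have hd : (p - q + 1 : ℚ) ≠ 0 := by
      have : (q : ℚ) < p := by exact_mod_cast hlt
      linarith
    have hxe : x = (p - q + 1 : ℚ)⁻¹ • ((L * x + (p : ℚ) • x) - (L * x + (q - 1 : ℚ) • x)) := by
      rw [eq_inv_smul_iff₀ hd]
      module
    rw [hxe]
    exact Submodule.smul_mem _ _
      (Submodule.sub_mem _ (Submodule.subset_span m1) (Submodule.subset_span m0))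

theorem IsThreeSymmetrizerFree.one_mem_span_contentVectors {n : ℕ} {T : ℕ → ℕ → A}
    (h : IsThreeSymmetrizerFree n T) {m : ℕ} (hm : m ≤ n) :
    (1 : A) ∈ Submodule.span ℚ (contentVectors T m) := by
  induction m with
  | zero => exact Submodule.subset_span ⟨fun _ => 0, by simp, by simp⟩
  | succ m ih => exact Submodule.span_le.mpr (h.contentVectors_subset_span hm) (ih (by omega))

end JucysMurphy

section Transpositions

variable {A : Type*} [Ring A] {n : ℕ}

/-- The images of the transpositions under a monoid homomorphism from the symmetric group on
`Fin n`, indexed by natural numbers (with value `1` out of range). -/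
noncomputable def transpositionFamily (g : Equiv.Perm (Fin n) →* A) (i j : ℕ) : A :=
  if h : i < n ∧ j < n then g (Equiv.swap ⟨i, h.1⟩ ⟨j, h.2⟩) else 1

theorem transpositionFamily_val (g : Equiv.Perm (Fin n) →* A) (i j : Fin n) :
    transpositionFamily g i j = g (Equiv.swap i j) :=
  dif_pos ⟨i.2, j.2⟩

theorem val_swap_apply (i j k : Fin n) :
    ((Equiv.swap i j k : Fin n) : ℕ) = Equiv.swap (i : ℕ) j k := by
  simp only [Equiv.swap_apply_def, Fin.ext_iff]
  split_ifs <;> rfl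

theorem exists_perm_apply_eq {α : Type*} [DecidableEq α] {a b c i j k : α}
    (hab : a ≠ b) (hac : a ≠ c) (hbc : b ≠ c) (hij : i ≠ j) (hik : i ≠ k) (hjk : j ≠ k) :
    ∃ π : Equiv.Perm α, π a = i ∧ π b = j ∧ π c = k := by
  obtain ⟨σ, ha, hb⟩ : ∃ σ : Equiv.Perm α, σ a = i ∧ σ b = j := by
    refine ⟨Equiv.swap (Equiv.swap a i b) j * Equiv.swap a i, ?_, ?_⟩
    · have : i ≠ Equiv.swap a i b := fun h => hab <| (Equiv.swap a i).injective <| by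
        rw [Equiv.swap_apply_left, ← h]
      rw [Equiv.Perm.mul_apply, Equiv.swap_apply_left, Equiv.swap_apply_of_ne_of_ne this hij]
    · rw [Equiv.Perm.mul_apply, Equiv.swap_apply_left]
  have hi : i ≠ σ c := fun h => hac <| σ.injective <| by rw [ha, ← h]
  have hj : j ≠ σ c := fun h => hbc <| σ.injective <| by rw [hb, ← h]
  refine ⟨Equiv.swap (σ c) k * σ, ?_, ?_, ?_⟩
  · rw [Equiv.Perm.mul_apply, ha, Equiv.swap_apply_of_ne_of_ne hi hik]
  · rw [Equiv.Perm.mul_apply, hb, Equiv.swap_apply_of_ne_of_ne hj hjk]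
  · rw [Equiv.Perm.mul_apply, Equiv.swap_apply_left]

/-- If the sum over the symmetric group on the first three letters is sent to zero, then so is
the sum over the symmetric group on any three letters. -/
theorem isThreeSymmetrizerFree_transpositionFamily (g : Equiv.Perm (Fin n) →* A)
    (hg : ∀ a b c : Fin n, (a : ℕ) = 0 → (b : ℕ) = 1 → (c : ℕ) = 2 →
      1 + g (Equiv.swap a b) + g (Equiv.swap a c) + g (Equiv.swap b c)
        + g (Equiv.swap a c) * g (Equiv.swap b c) + g (Equiv.swap b c) * g (Equiv.swap a c) = 0) :
    IsThreeSymmetrizerFree n (transpositionFamily g) where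
  symm i j := by
    simp only [transpositionFamily, and_comm (a := i < n)]
    split_ifs
    · rw [Equiv.swap_comm]
    · rfl
  diag i := by
    simp [transpositionFamily, ← Equiv.Perm.one_def]
  sq i j := by
    rw [transpositionFamily]
    split_ifs
    · rw [← map_mul, Equiv.swap_mul_self, map_one]
    · rw [one_mul]
  conj {i j k l} hi hj hk hl := by
    lift i to Fin n using hi
    lift j to Fin n using hj
    lift k to Fin n using hk
    lift l to Fin n using hl
    simp only [← val_swap_apply, transpositionFamily_val, ← map_mul]
    rw [Equiv.mul_swap_eq_swap_mul]
  symmetrizer {i j k} hi hj hk hij hik hjk := by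
    lift i to Fin n using hi
    lift j to Fin n using hj
    lift k to Fin n using hk
    have hn : 2 < n := by omega
    simp only [transpositionFamily_val]
    obtain ⟨π, rfl, rfl, rfl⟩ := exists_perm_apply_eq (a := (⟨0, by omega⟩ : Fin n))
      (b := ⟨1, by omega⟩) (c := ⟨2, hn⟩) (by simp) (by simp) (by simp)
      (Fin.val_ne_iff.mp hij) (Fin.val_ne_iff.mp hik) (Fin.val_ne_iff.mp hjk)
    have h0 := hg ⟨0, by omega⟩ ⟨1, by omega⟩ ⟨2, hn⟩ rfl rfl rfl
    have hconj : ∀ x y : Fin n,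
        g (Equiv.swap (π x) (π y)) = g π * g (Equiv.swap x y) * g π⁻¹ := by
      intro x y
      rw [← map_mul, ← map_mul, Equiv.mul_swap_eq_swap_mul, mul_inv_cancel_right]
    have hinv : g π⁻¹ * g π = 1 := by rw [← map_mul, inv_mul_cancel, map_one]
    have hinv' : g π * g π⁻¹ = 1 := by rw [← map_mul, mul_inv_cancel, map_one]
    have hmul : ∀ x y : A, g π * x * g π⁻¹ * (g π * y * g π⁻¹) = g π * (x * y) * g π⁻¹ := by
      intro x y
      rw [← mul_assoc, ← mul_assoc, mul_assoc (g π * x), hinv, mul_one, mul_assoc (g π) x]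
    have := congrArg (g π * · * g π⁻¹) h0
    simp only [hconj, hmul]
    simpa only [mul_add, add_mul, mul_one, hinv', mul_zero, zero_mul] using this

end Transpositions

theorem TLu_braid {R : Type} [CommRing R] {n : ℕ} (i j : Fin (n - 1))
    (h : Nat.dist i.val j.val = 1) : TLu R n i * TLu R n j * TLu R n i = TLu R n i := by
  simpa [TLu] using RingQuot.mkAlgHom_rel R (TLRel.braid (R := R) i j h)

theorem isThreeSymmetrizerFree_TL {n : ℕ} (Φ : SymGrpAlg ℚ n →ₐ[ℚ] TL ℚ n)
    (hΦ : ∀ i : Fin (n - 1),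
      Φ (MonoidAlgebra.of ℚ (Equiv.Perm (Fin n)) (simpleT n i)) = TLu ℚ n i - 1) :
    IsThreeSymmetrizerFree n (transpositionFamily
      ((Φ : SymGrpAlg ℚ n →* TL ℚ n).comp (MonoidAlgebra.of ℚ (Equiv.Perm (Fin n))))) := by
  apply isThreeSymmetrizerFree_transpositionFamily
  set g := (Φ : SymGrpAlg ℚ n →* TL ℚ n).comp (MonoidAlgebra.of ℚ (Equiv.Perm (Fin n)))
  rintro ⟨a, ha⟩ ⟨b, hb⟩ ⟨c, hc⟩ h0 h1 h2
  dsimp only at h0 h1 h2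
  subst h0 h1 h2
  have hs : g (Equiv.swap ⟨0, ha⟩ ⟨1, hb⟩) = TLu ℚ n ⟨0, by omega⟩ - 1 := hΦ ⟨0, by omega⟩
  have ht : g (Equiv.swap ⟨1, hb⟩ ⟨2, hc⟩) = TLu ℚ n ⟨1, by omega⟩ - 1 := hΦ ⟨1, by omega⟩
  have hconj : (Equiv.swap ⟨0, ha⟩ ⟨2, hc⟩ : Equiv.Perm (Fin n)) =
      Equiv.swap ⟨0, ha⟩ ⟨1, hb⟩ * Equiv.swap ⟨1, hb⟩ ⟨2, hc⟩ * Equiv.swap ⟨0, ha⟩ ⟨1, hb⟩ := by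
    rw [Equiv.swap_comm (⟨0, ha⟩ : Fin n) ⟨1, hb⟩, Equiv.swap_comm (⟨1, hb⟩ : Fin n) ⟨2, hc⟩,
      Equiv.swap_mul_swap_mul_swap (by simp) (by simp)]
  have hconj' : (Equiv.swap ⟨0, ha⟩ ⟨2, hc⟩ : Equiv.Perm (Fin n)) =
      Equiv.swap ⟨1, hb⟩ ⟨2, hc⟩ * Equiv.swap ⟨0, ha⟩ ⟨1, hb⟩ * Equiv.swap ⟨1, hb⟩ ⟨2, hc⟩ := by
    rw [Equiv.swap_mul_swap_mul_swap (by simp) (by simp), Equiv.swap_comm]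
  have hbraid := TLu_braid (R := ℚ) (⟨0, by omega⟩ : Fin (n - 1)) ⟨1, by omega⟩ (by simp [Nat.dist])
  have hss : g (Equiv.swap ⟨0, ha⟩ ⟨1, hb⟩) * g (Equiv.swap ⟨0, ha⟩ ⟨1, hb⟩) = 1 := by
    rw [← map_mul, Equiv.swap_mul_self, map_one]
  have hst : g (Equiv.swap ⟨0, ha⟩ ⟨2, hc⟩) * g (Equiv.swap ⟨1, hb⟩ ⟨2, hc⟩) =
      g (Equiv.swap ⟨1, hb⟩ ⟨2, hc⟩) * g (Equiv.swap ⟨0, ha⟩ ⟨1, hb⟩) := by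
    rw [hconj', ← map_mul, ← map_mul, mul_assoc, Equiv.swap_mul_self, mul_one]
  have hts : g (Equiv.swap ⟨1, hb⟩ ⟨2, hc⟩) * g (Equiv.swap ⟨0, ha⟩ ⟨2, hc⟩) =
      g (Equiv.swap ⟨0, ha⟩ ⟨1, hb⟩) * g (Equiv.swap ⟨1, hb⟩ ⟨2, hc⟩) := by
    rw [hconj', ← map_mul, ← map_mul, ← mul_assoc, ← mul_assoc, Equiv.swap_mul_self, one_mul]
  rw [hst, hts, hconj, map_mul, map_mul]
  rw [sub_eq_iff_eq_add.mp hs.symm, sub_eq_iff_eq_add.mp ht.symm] at hbraid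
  simp only [mul_add, add_mul, hss, one_mul, mul_one] at hbraid
  rw [← sub_eq_zero] at hbraid
  rw [← hbraid]
  abel

theorem card_filter_le_eq_count {n : ℕ} (p : ℕ → Prop) [DecidablePred p] (j : Fin n) :
    (Finset.univ.filter fun i : Fin n => i ≤ j ∧ p i).card = Nat.count p (j + 1) := by
  rw [Nat.count_eq_card_filter_range]
  refine Finset.card_bij (fun i _ => i) (fun i hi => ?_) (fun _ _ _ _ => Fin.ext) (fun i hi => ?_)
  · simp only [Finset.mem_filter, Finset.mem_univ, true_and, Finset.mem_range] at hi ⊢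
    exact ⟨Nat.lt_succ_of_le hi.1, hi.2⟩
  · simp only [Finset.mem_filter, Finset.mem_univ, true_and, Finset.mem_range] at hi ⊢
    exact ⟨⟨i, by omega⟩, ⟨Fin.le_def.mpr (by simp; omega), hi.2⟩, rfl⟩

theorem colContent_eq_wordContent {n : ℕ} (c : ℕ → Fin 2) (j : Fin n) :
    colContent (fun i : Fin n => c i) j = wordContent c j := by
  rw [colContent, wordContent, card_filter_le_eq_count (c · = 0), card_filter_le_eq_count (c · = 1),
    Nat.count_succ, Nat.count_succ]
  by_cases hc : c j = 0
  · simp [hc]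
  · have hc1 : c j = 1 := by omega
    simp [hc1]; ring

namespace TwoColTab

variable {n : ℕ}

/-- The column word of a tableau, extended by zero. -/
def word (t : TwoColTab n) (l : ℕ) : Fin 2 := if h : l < n then t.col ⟨l, h⟩ else 0

theorem word_val (t : TwoColTab n) (i : Fin n) : t.word i = t.col i := dif_pos i.2

theorem tabContent_eq (t : TwoColTab n) (i : Fin n) : tabContent t i = wordContent t.word i := by
  rw [tabContent, ← colContent_eq_wordContent]
  simp only [word_val]

theorem count_word_le (t : TwoColTab n) {l : ℕ} (hl : l ≤ n) :
    Nat.count (t.word · = 1) l ≤ Nat.count (t.word · = 0) l := by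
  rcases l with _ | l
  · simp
  · have := t.ballot ⟨l, hl⟩
    simp only [← word_val] at this
    rwa [card_filter_le_eq_count (t.word · = 0), card_filter_le_eq_count (t.word · = 1)] at this

/-- A two-column standard tableau is determined by its contents. -/
theorem eq_of_tabContent_eq {s t : TwoColTab n} (h : ∀ i, tabContent s i = tabContent t i) :
    s = t := by
  have hw : ∀ l < n, s.word l = t.word l := by
    intro l
    induction l using Nat.strong_induction_on with
    | _ l ih =>
      intro hl
      have hcount : ∀ k : Fin 2, Nat.count (s.word · = k) l = Nat.count (t.word · = k) l := by
        intro k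
        rw [Nat.count_eq_card_filter_range, Nat.count_eq_card_filter_range]
        congr 1
        refine Finset.filter_congr fun i hi => ?_
        rw [Finset.mem_range] at hi
        rw [ih i hi (hi.trans hl)]
      have hc := h ⟨l, hl⟩
      rw [tabContent_eq, tabContent_eq, wordContent, wordContent] at hc
      have hle := s.count_word_le hl.le
      simp only [hcount] at hc hle
      split_ifs at hc <;> omega
  refine TwoColTab.ext' (funext fun i => ?_)
  rw [← word_val, ← word_val, hw i i.2]

theorem tabContent_mem_contSet (t : TwoColTab n) (i : Fin n) : tabContent t i ∈ ContSet n :=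
  Finset.mem_image.mpr ⟨(t.col, i), by simpa using t.ballot, rfl⟩

end TwoColTab

section ListProducts

variable {A ι : Type*} [Ring A] [Algebra ℚ A]

theorem list_prod_map_mul_eq_smul {l : List ι} {f : ι → A} {r : ι → ℚ} {x : A}
    (h : ∀ a ∈ l, f a * x = r a • x) : (l.map f).prod * x = (l.map r).prod • x := by
  induction l with
  | nil => simp
  | cons a l ih =>
    rw [List.map_cons, List.prod_cons, mul_assoc, ih fun b hb => h b (List.mem_cons_of_mem _ hb),
      mul_smul_comm, h a List.mem_cons_self, smul_smul, List.map_cons, List.prod_cons, mul_comm]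

theorem smul_sub_intCast_mul {x y : A} {a : ℤ} (h : y * x = (a : ℚ) • x) (q : ℚ) (d : ℤ) :
    q • (y - (d : A)) * x = (q * (a - d)) • x := by
  have hd : (d : A) * x = (d : ℚ) • x := by
    rw [Int.cast_smul_eq_zsmul, zsmul_eq_mul]
  rw [smul_mul_assoc, sub_mul, h, hd, ← sub_smul, smul_smul]

end ListProducts

section Eelt

variable {n : ℕ} {L : Fin n → TL ℚ n}

theorem Eelt_mul_eq_smul (t : TwoColTab n) {x : TL ℚ n} {a : Fin n → ℤ}
    (hx : ∀ i, L i * x = (a i : ℚ) • x) :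
    Eelt n L t * x = (((ContSet n).sort (· ≤ ·)).map fun d =>
      (((List.finRange n).filter fun i => tabContent t i ≠ d).map fun i =>
        ((tabContent t i - d : ℤ) : ℚ)⁻¹ * (a i - d)).prod).prod • x := by
  exact list_prod_map_mul_eq_smul fun d _ => list_prod_map_mul_eq_smul fun i _ =>
    smul_sub_intCast_mul (hx i) _ d

theorem Eelt_mul_self_vector {t : TwoColTab n} {x : TL ℚ n}
    (hx : ∀ i, L i * x = (tabContent t i : ℚ) • x) : Eelt n L t * x = x := by
  rw [Eelt_mul_eq_smul t hx]
  convert one_smul ℚ x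
  refine List.prod_eq_one fun r hr => ?_
  obtain ⟨d, -, rfl⟩ := List.mem_map.mp hr
  refine List.prod_eq_one fun r hr => ?_
  obtain ⟨i, hi, rfl⟩ := List.mem_map.mp hr
  have hne : tabContent t i ≠ d := by simpa using hi
  push_cast
  exact inv_mul_cancel₀ (sub_ne_zero.mpr (by exact_mod_cast hne))

theorem Eelt_mul_of_ne {s t : TwoColTab n} (hst : s ≠ t) {x : TL ℚ n}
    (hx : ∀ i, L i * x = (tabContent t i : ℚ) • x) : Eelt n L s * x = 0 := by
  obtain ⟨i, hi⟩ : ∃ i, tabContent s i ≠ tabContent t i := by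
    by_contra! hall
    exact hst (TwoColTab.eq_of_tabContent_eq hall)
  rw [Eelt_mul_eq_smul s hx, List.prod_eq_zero, zero_smul]
  refine List.mem_map.mpr ⟨tabContent t i, by simpa using t.tabContent_mem_contSet i, ?_⟩
  refine List.prod_eq_zero (List.mem_map.mpr ⟨i, by simpa using hi, ?_⟩)
  rw [sub_self, mul_zero]

theorem commute_Eelt (hL : ∀ i j, Commute (L i) (L j)) (i : Fin n) (t : TwoColTab n) :
    Commute (L i) (Eelt n L t) := by
  refine Commute.list_prod_right _ _ fun y hy => ?_
  obtain ⟨d, -, rfl⟩ := List.mem_map.mp hy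
  refine Commute.list_prod_right _ _ fun y hy => ?_
  obtain ⟨j, -, rfl⟩ := List.mem_map.mp hy
  exact ((hL i j).sub_right (Int.commute_cast _ _)).smul_right _

/-- If the identity is a combination of joint eigenvectors whose eigenvalues are the contents of
two-column standard tableaux, then an element is determined by its action on such vectors. -/
theorem eq_of_mul_eq_mul_on_vectors
    (h1 : (1 : TL ℚ n) ∈ Submodule.span ℚ
      {x | ∃ t : TwoColTab n, ∀ i, L i * x = (tabContent t i : ℚ) • x})
    {a b : TL ℚ n}
    (hab : ∀ (t : TwoColTab n) (x : TL ℚ n), (∀ i, L i * x = (tabContent t i : ℚ) • x) →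
      a * x = b * x) : a = b := by
  have := LinearMap.eqOn_span (f := LinearMap.mulLeft ℚ a) (g := LinearMap.mulLeft ℚ b)
    (by rintro x ⟨t, hx⟩; exact hab t x hx) h1
  simpa using this

end Eelt

theorem jucysMurphy_transpositionFamily {n : ℕ} (Φ : SymGrpAlg ℚ n →ₐ[ℚ] TL ℚ n) (l : Fin n) :
    jucysMurphy (transpositionFamily
      ((Φ : SymGrpAlg ℚ n →* TL ℚ n).comp (MonoidAlgebra.of ℚ (Equiv.Perm (Fin n))))) l =
      Φ (JMelt ℚ n l) := by
  rw [jucysMurphy, JMelt, map_sum]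
  symm
  refine Finset.sum_bij (fun j _ => j) (fun j hj => ?_) (fun _ _ _ _ => Fin.ext)
    (fun j hj => ?_) (fun j _ => ?_)
  · exact Finset.mem_range.mpr (Finset.mem_filter.mp hj).2
  · rw [Finset.mem_range] at hj
    exact ⟨⟨j, hj.trans l.2⟩, Finset.mem_filter.mpr ⟨Finset.mem_univ _, hj⟩, rfl⟩
  · rw [transpositionFamily_val]
    rfl

/-- In `TL_n^ℚ` (with `Φ : ℚ𝔖_n → TL_n^ℚ` the homomorphism
`s_i ↦ u_i − 1` and `𝐋_i = Φ(L_i)` the Jucys–Murphy elements), the seminormal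
idempotents `E_t`, `t ∈ Std(Par^{≤2}_n)`, satisfy `Σ_t E_t = 1`,
`E_s E_t = δ_{s,t} E_s`, and `𝐋_i E_t = E_t 𝐋_i = c_t(i) E_t`. -/
theorem Eelt_complete_orthogonal_eigen (n : ℕ)
    (Φ : SymGrpAlg ℚ n →ₐ[ℚ] TL ℚ n)
    (hΦ : ∀ i : Fin (n - 1),
      Φ (MonoidAlgebra.of ℚ (Equiv.Perm (Fin n)) (simpleT n i)) = TLu ℚ n i - 1) :
    (∑ t : TwoColTab n, Eelt n (fun l => Φ (JMelt ℚ n l)) t = 1) ∧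
    (∀ s t : TwoColTab n,
      (s = t → Eelt n (fun l => Φ (JMelt ℚ n l)) s * Eelt n (fun l => Φ (JMelt ℚ n l)) t =
        Eelt n (fun l => Φ (JMelt ℚ n l)) s) ∧
      (s ≠ t → Eelt n (fun l => Φ (JMelt ℚ n l)) s * Eelt n (fun l => Φ (JMelt ℚ n l)) t = 0)) ∧
    (∀ (t : TwoColTab n) (i : Fin n),
      Φ (JMelt ℚ n i) * Eelt n (fun l => Φ (JMelt ℚ n l)) t =
          ((tabContent t i : ℤ) : ℚ) • Eelt n (fun l => Φ (JMelt ℚ n l)) t ∧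
      Eelt n (fun l => Φ (JMelt ℚ n l)) t * Φ (JMelt ℚ n i) =
          ((tabContent t i : ℤ) : ℚ) • Eelt n (fun l => Φ (JMelt ℚ n l)) t) := by
  have hT := isThreeSymmetrizerFree_TL Φ hΦ
  set L : Fin n → TL ℚ n := fun l => Φ (JMelt ℚ n l) with hLdef
  have hL := jucysMurphy_transpositionFamily Φ
  have hcomm : ∀ i j, Commute (L i) (L j) := by
    intro i j
    simp only [hLdef, ← hL]
    exact hT.jucysMurphy_commute i.2 j.2
  have h1 : (1 : TL ℚ n) ∈ Submodule.span ℚ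
      {x | ∃ t : TwoColTab n, ∀ i, L i * x = (tabContent t i : ℚ) • x} := by
    refine Submodule.span_mono ?_ (hT.one_mem_span_contentVectors le_rfl)
    rintro x ⟨c, hb, hx⟩
    refine ⟨⟨fun i => c i, fun m => ?_⟩, fun i => ?_⟩
    · rw [card_filter_le_eq_count (c · = 0), card_filter_le_eq_count (c · = 1)]
      exact hb _ m.2
    · simp only [hLdef, ← hL]
      rw [tabContent, colContent_eq_wordContent]
      exact hx i i.2
  have heig : ∀ (t : TwoColTab n) (i : Fin n),
      L i * Eelt n L t = ((tabContent t i : ℤ) : ℚ) • Eelt n L t := by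
    intro t i
    refine eq_of_mul_eq_mul_on_vectors h1 fun s x hx => ?_
    rw [mul_assoc, smul_mul_assoc]
    by_cases hts : t = s
    · subst hts
      rw [Eelt_mul_self_vector hx, hx]
    · rw [Eelt_mul_of_ne hts hx, mul_zero, smul_zero]
  refine ⟨?_, fun s t => ⟨?_, fun hst => Eelt_mul_of_ne hst (heig t)⟩, fun t i => ⟨heig t i, ?_⟩⟩
  · refine eq_of_mul_eq_mul_on_vectors h1 fun s x hx => ?_
    rw [Finset.sum_mul, Finset.sum_eq_single s (fun t _ hts => Eelt_mul_of_ne hts hx)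
      (fun hs => absurd (Finset.mem_univ s) hs), Eelt_mul_self_vector hx, one_mul]
  · rintro rfl
    exact Eelt_mul_self_vector (heig s)
  · rw [← (commute_Eelt hcomm i t).eq, heig]
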